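/- The graph F(9,15,34), defined as the simple graph on vertex set {1,...,9} with edge set {{1,2},{1,3},{2,3},{2,4},{3,4},{3,5},{5,6},{4,6},{5,7},{6,7},{7,8},{6,9},{8,9},{1,8},{1,9}}, is forbidden: there is no injective map φ : {1,...,9} → ℝ² with dist(φ(i), φ(j)) = 1 for every edge {i,j}. -/

import Mathlib

open ComplexConjugate in
lemma aux_conj {u : ℂ} (h : ‖u‖ = 1) : u * conj u = 1 := by
  rw [Complex.mul_conj, Complex.normSq_eq_norm_sq, h]; norm_num

open ComplexConjugate in
lemma aux_zero_sum {u v w x : ℂ} (hu : ‖u‖ = 1) (hv : ‖v‖ = 1) (hw : ‖w‖ = 1) (hx : ‖x‖ = 1)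
    (h : u + v + w + x = 0) : u + v = 0 ∨ u + w = 0 ∨ u + x = 0 := by
  have h1 := aux_conj hu
  have h2 := aux_conj hv
  have h3 := aux_conj hw
  have h4 := aux_conj hx
  have hc : conj u + conj v + conj w + conj x = 0 := by
    rw [← map_add, ← map_add, ← map_add, h, map_zero]
  have key : (u + v) * ((u + w) * (u + x)) = 0 := by
    linear_combination u ^ 2 * h + u * v * w * x * hc - v * w * x * h1 - u * w * x * h2
      - u * v * x * h3 - u * v * w * h4
  rcases mul_eq_zero.1 key with h | h
  · exact Or.inl h
  · exact Or.inr (mul_eq_zero.1 h)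

lemma aux_rhombus {p q r s : ℂ} (h1 : ‖p - q‖ = 1) (h2 : ‖q - r‖ = 1) (h3 : ‖r - s‖ = 1)
    (h4 : ‖s - p‖ = 1) (hpr : p ≠ r) (hqs : q ≠ s) : p + r = q + s := by
  rcases aux_zero_sum h1 h2 h3 h4 (by ring) with h | h | h
  · exact absurd (by linear_combination h) hpr
  · linear_combination h
  · exact absurd (by linear_combination -h) hqs

open ComplexConjugate in
lemma aux_cross {a b : ℂ} (ha : ‖a‖ = 1) (hb : ‖b‖ = 1) (hab : ‖a - b‖ = 1) :
    a * conj b + b * conj a = 1 := by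
  have h1 := aux_conj ha
  have h2 := aux_conj hb
  have h3 := aux_conj hab
  rw [map_sub] at h3
  linear_combination h1 + h2 - h3

open ComplexConjugate in
lemma aux_tri {a b : ℂ} (ha : ‖a‖ = 1) (hb : ‖b‖ = 1) (hab : ‖a - b‖ = 1) :
    a ^ 2 - a * b + b ^ 2 = 0 := by
  have h1 := aux_conj ha
  have h2 := aux_conj hb
  have h3 := aux_cross ha hb hab
  linear_combination a * b * h3 - a ^ 2 * h2 - b ^ 2 * h1

open ComplexConjugate in
lemma aux_seven {a e b c : ℂ} (ha : ‖a‖ = 1) (he : ‖e‖ = 1) (hae : ‖a - e‖ = 1)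
    (hb : ‖b‖ = 1) (hc : ‖c‖ = 1) (h : b + c = 2 * e - 3 * a) : False := by
  have h1 := aux_conj ha
  have h2 := aux_conj he
  have h3 := aux_cross ha he hae
  have h4 : (2 * e - 3 * a) * conj (2 * e - 3 * a) = 7 := by
    simp only [map_sub, map_mul, map_ofNat]
    linear_combination 4 * h2 + 9 * h1 - 6 * h3
  rw [Complex.mul_conj, Complex.normSq_eq_norm_sq, ← h] at h4
  have h5 : ‖b + c‖ ^ 2 = 7 := by exact_mod_cast h4
  have h6 := norm_add_le b c
  rw [hb, hc] at h6
  nlinarith [norm_nonneg (b + c)]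

lemma aux_main (z : ℕ → ℂ) (h36 : z 3 ≠ z 6) (h25 : z 2 ≠ z 5) (h24 : z 2 ≠ z 4)
    (h14 : z 1 ≠ z 4) (h23 : z 2 ≠ z 3) (h54 : z 5 ≠ z 4) (h68 : z 6 ≠ z 8) (h79 : z 7 ≠ z 9)
    (h34 : z 3 ≠ z 4)
    (d : ℕ → ℕ → Prop) (hd : ∀ i j, d i j → ‖z i - z j‖ = 1) (hs : ∀ i j, d i j → d j i)
    (d12 : d 1 2) (d13 : d 1 3) (d23 : d 2 3) (d24 : d 2 4) (d34 : d 3 4) (d35 : d 3 5)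
    (d56 : d 5 6) (d46 : d 4 6) (d57 : d 5 7) (d67 : d 6 7) (d78 : d 7 8) (d69 : d 6 9)
    (d89 : d 8 9) (d18 : d 1 8) (d19 : d 1 9) : False := by
  have r1 : z 1 + z 4 = z 2 + z 3 := aux_rhombus (hd _ _ d12) (hd _ _ d24)
    (hd _ _ (hs _ _ d34)) (hd _ _ (hs _ _ d13)) h14 h23
  have r2 : z 3 + z 6 = z 5 + z 4 := aux_rhombus (hd _ _ d35) (hd _ _ d56)
    (hd _ _ (hs _ _ d46)) (hd _ _ (hs _ _ d34)) h36 h54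
  have r3 : z 6 + z 8 = z 7 + z 9 := aux_rhombus (hd _ _ d67) (hd _ _ d78)
    (hd _ _ d89) (hd _ _ (hs _ _ d69)) h68 h79
  obtain ⟨a, ha⟩ : ∃ a, a = z 4 - z 3 := ⟨_, rfl⟩
  obtain ⟨e, he⟩ : ∃ e, e = z 2 - z 3 := ⟨_, rfl⟩
  obtain ⟨b, hb⟩ : ∃ b, b = z 5 - z 3 := ⟨_, rfl⟩
  obtain ⟨c, hc⟩ : ∃ c, c = z 9 - z 6 := ⟨_, rfl⟩
  obtain ⟨f, hf⟩ : ∃ f, f = z 7 - z 5 := ⟨_, rfl⟩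
  have na : ‖a‖ = 1 := by rw [ha]; exact hd _ _ (hs _ _ d34)
  have ne : ‖e‖ = 1 := by rw [he]; exact hd _ _ d23
  have nb : ‖b‖ = 1 := by rw [hb]; exact hd _ _ (hs _ _ d35)
  have nc : ‖c‖ = 1 := by rw [hc]; exact hd _ _ (hs _ _ d69)
  have nf : ‖f‖ = 1 := by rw [hf]; exact hd _ _ (hs _ _ d57)
  have nae : ‖a - e‖ = 1 := by
    rw [← hd _ _ (hs _ _ d24)]; congr 1; linear_combination ha - he
  have naf : ‖a - f‖ = 1 := by
    rw [← hd _ _ d67]; congr 1; linear_combination ha - hf - r2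
  have t1 := aux_tri na ne nae
  have t2 := aux_tri na nf naf
  have t3 := aux_tri (hd _ _ d19) (hd _ _ d89)
    (by rw [← hd _ _ d18]; congr 1; ring)
  have e89 : z 8 - z 9 = f - a := by linear_combination r3 - hf + ha - r2
  have e19 : z 1 - z 9 = e - 2 * a - b - c := by
    linear_combination r1 - he + 2 * ha + hb + hc - r2
  rw [e89, e19] at t3
  have hg : (e - a - b - c) * (e - 2 * a - b - c - f) = 0 := by
    linear_combination t3 - t2
  have noa : b + a ≠ 0 := fun h => h36 (by linear_combination -h + hb + ha - r2)
  have noe : b - e ≠ 0 := fun h => h25 (by linear_combination -h + hb - he)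
  rcases mul_eq_zero.1 hg with h | h
  · rcases aux_zero_sum nb nc na (x := -e) (by rw [norm_neg, ne]) (by linear_combination -h)
      with h' | h' | h'
    · exact h24 (by linear_combination h + h' - he + ha)
    · exact noa h'
    · exact noe (by linear_combination h')
  · have hh : (e - f) * (e + f - a) = 0 := by linear_combination t1 - t2
    rcases mul_eq_zero.1 hh with k | k
    · rcases aux_zero_sum nb nc na na (by linear_combination k - h) with h' | h' | h'
      · exact h34 (by linear_combination (1/2) * h + (1/2) * h' - (1/2) * k + ha)
      · exact noa h'
      · exact noa h'
    · exact aux_seven na ne nae nb nc (by linear_combination -h - k)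

theorem F_9_15_34_forbidden :
    ¬ ∃ φ : ℕ → EuclideanSpace ℝ (Fin 2),
      Set.InjOn φ (Set.Icc 1 9) ∧
      dist (φ 1) (φ 2) = 1 ∧
      dist (φ 1) (φ 3) = 1 ∧
      dist (φ 2) (φ 3) = 1 ∧
      dist (φ 2) (φ 4) = 1 ∧
      dist (φ 3) (φ 4) = 1 ∧
      dist (φ 3) (φ 5) = 1 ∧
      dist (φ 5) (φ 6) = 1 ∧
      dist (φ 4) (φ 6) = 1 ∧
      dist (φ 5) (φ 7) = 1 ∧
      dist (φ 6) (φ 7) = 1 ∧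
      dist (φ 7) (φ 8) = 1 ∧
      dist (φ 6) (φ 9) = 1 ∧
      dist (φ 8) (φ 9) = 1 ∧
      dist (φ 1) (φ 8) = 1 ∧
      dist (φ 1) (φ 9) = 1 := by
  rintro ⟨φ, inj, d12, d13, d23, d24, d34, d35, d56, d46, d57, d67, d78, d69, d89, d18, d19⟩
  let L := Complex.orthonormalBasisOneI.repr.symm
  have hne : ∀ i j : ℕ, 1 ≤ i → i ≤ 9 → 1 ≤ j → j ≤ 9 → i ≠ j → L (φ i) ≠ L (φ j) :=
    fun i j h1 h2 h3 h4 hij h => hij (inj ⟨h1, h2⟩ ⟨h3, h4⟩ (L.injective h))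
  refine aux_main (fun i => L (φ i)) ?_ ?_ ?_ ?_ ?_ ?_ ?_ ?_ ?_
    (fun i j => dist (φ i) (φ j) = 1) ?_ ?_
    d12 d13 d23 d24 d34 d35 d56 d46 d57 d67 d78 d69 d89 d18 d19
  iterate 9 exact hne _ _ (by norm_num) (by norm_num) (by norm_num) (by norm_num) (by norm_num)
  · intro i j h
    rw [← dist_eq_norm]
    exact (L.dist_map _ _).trans h
  · intro i j h
    rw [dist_comm]
    exact h
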